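/- Suppose there exist positive functions f and g on (0,1) and a sequence of positive real numbers (a(n))_{n ≥ 1} such that, for every positive integer n, every nontrivial monotone symmetric subset A ⊆ {0,1}^n, and every p ∈ (0,1), the derivative satisfies dμ_p(A)/dp ≥ (a(n)/g(p)) · f(μ_p(A)), where moreover f(x)/x → 1 as x → 0 and g(p)/(p·log(1/p)) → 1 as p → 0. Then limsup_{n → ∞} a(n)/log n ≤ 1. -/

import Mathlib

open Finset

/-- Weight of a point `x ∈ {0,1}^n` under the product Bernoulli(p) measure:
`p^{∑ xᵢ} (1-p)^{∑ (1-xᵢ)}`. -/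
noncomputable def muW (n : ℕ) (p : ℝ) (x : Fin n → Bool) : ℝ :=
  ∏ i : Fin n, if x i then p else 1 - p

/-- The measure `μ_{n,p}(A)` of a subset `A ⊆ {0,1}^n`. -/
noncomputable def muP (n : ℕ) (p : ℝ) (A : Finset (Fin n → Bool)) : ℝ :=
  ∑ x ∈ A, muW n p x

/-- Expectation `∫ f dμ_{n,p}` of a real function on `{0,1}^n`. -/
noncomputable def muE (n : ℕ) (p : ℝ) (f : (Fin n → Bool) → ℝ) : ℝ :=
  ∑ x : Fin n → Bool, muW n p x * f x

/-- `A` is monotone: `x ∈ A` and `x ≤ y` coordinatewise imply `y ∈ A`. -/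
def MonotoneSet (n : ℕ) (A : Finset (Fin n → Bool)) : Prop :=
  ∀ x ∈ A, ∀ y : Fin n → Bool, (∀ i, x i ≤ y i) → y ∈ A

/-- `A` is symmetric: invariant under a transitive subgroup of permutations of coordinates. -/
def SymmetricSet (n : ℕ) (A : Finset (Fin n → Bool)) : Prop :=
  ∃ G : Subgroup (Equiv.Perm (Fin n)),
    (∀ i j : Fin n, ∃ g ∈ G, g i = j) ∧
    (∀ g ∈ G, ∀ x ∈ A, (fun i => x (g⁻¹ i)) ∈ A)

/-- Discrete gradient `∇_i f`. -/
noncomputable def grad (n : ℕ) (i : Fin n) (f : (Fin n → Bool) → ℝ)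
    (x : Fin n → Bool) : ℝ :=
  f (Function.update x i true) - f (Function.update x i false)

/-- The operator `Δ_i f = f - ∫ f dμ_{1,p}(x_i)`. -/
noncomputable def del (n : ℕ) (p : ℝ) (i : Fin n) (f : (Fin n → Bool) → ℝ)
    (x : Fin n → Bool) : ℝ :=
  f x - (p * f (Function.update x i true) + (1 - p) * f (Function.update x i false))

open Classical in
/-- Influence of coordinate `i` on a function `f`: the `μ_{n,p}`-probability
that `f` is not constant on the `i`-th fiber. -/
noncomputable def infl (n : ℕ) (p : ℝ) (i : Fin n) (f : (Fin n → Bool) → ℝ) : ℝ :=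
  muP n p (Finset.univ.filter fun x =>
    f (Function.update x i true) ≠ f (Function.update x i false))

open Classical in
/-- Influence of coordinate `i` on a set `A`. -/
noncomputable def inflSet (n : ℕ) (p : ℝ) (i : Fin n) (A : Finset (Fin n → Bool)) : ℝ :=
  muP n p (Finset.univ.filter fun x =>
    ¬((Function.update x i true ∈ A) ↔ (Function.update x i false ∈ A)))

/-- Entropy of a (nonnegative) function with respect to `μ_{n,p}`. -/
noncomputable def ent (n : ℕ) (p : ℝ) (g : (Fin n → Bool) → ℝ) : ℝ :=
  muE n p (fun x => g x * Real.log (g x)) - muE n p g * Real.log (muE n p g)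

/-- Variance of a function with respect to `μ_{n,p}`. -/
noncomputable def varE (n : ℕ) (p : ℝ) (f : (Fin n → Bool) → ℝ) : ℝ :=
  muE n p (fun x => f x ^ 2) - (muE n p f) ^ 2

/-- Conditional expectation `E[f | x_1, …, x_j]` under `μ_{n,p}`:
average over the last `n - j` coordinates. -/
noncomputable def condE (n : ℕ) (p : ℝ) (j : ℕ) (f : (Fin n → Bool) → ℝ)
    (x : Fin n → Bool) : ℝ :=
  ∑ y : Fin n → Bool,
    (∏ i : Fin n, if (i : ℕ) < j then (if y i = x i then (1 : ℝ) else 0)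
      else (if y i then p else 1 - p)) * f y

/-- The logarithmic Sobolev constant of the two-point Bernoulli(p) space. -/
noncomputable def cLS (p : ℝ) : ℝ :=
  if p = 1 / 2 then 2 else (Real.log (1 - p) - Real.log p) / (1 - 2 * p)

/-- The sequence `s(n)` of Theorem 4.1. -/
noncomputable def sseq (n : ℕ) : ℝ :=
  Real.log n -
    max (Real.log ((Real.exp 1 ^ (2 + 4 / Real.exp 1) / (2 : ℝ) ^ (5 + 4 / Real.exp 1)) *
        Real.log ((n : ℝ) / Real.log n ^ 2) ^ (3 + 4 / Real.exp 1)))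
      (2 * Real.log (Real.log n))


noncomputable def vW (n : ℕ) (p : ℝ) (x : Fin n → Bool) (i : Fin n) : ℝ :=
  ∏ j ∈ Finset.univ.erase i, if x j then p else 1 - p

lemma vW_nonneg (n : ℕ) (p : ℝ) (h0 : 0 ≤ p) (h1 : p ≤ 1) (x : Fin n → Bool) (i : Fin n) :
    0 ≤ vW n p x i := by
  unfold vW
  apply Finset.prod_nonneg
  intro j _
  split_ifs <;> linarith

lemma muW_pos (n : ℕ) (p : ℝ) (h0 : 0 < p) (h1 : p < 1) (x : Fin n → Bool) :
    0 < muW n p x := by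
  unfold muW
  apply Finset.prod_pos
  intro j _
  split_ifs <;> linarith

lemma p_mul_vW (n : ℕ) (p : ℝ) (x : Fin n → Bool) (i : Fin n) (h : x i = true) :
    p * vW n p x i = muW n p x := by
  unfold vW muW
  rw [← Finset.mul_prod_erase Finset.univ _ (Finset.mem_univ i)]
  simp [h]

lemma vW_update (n : ℕ) (p : ℝ) (x : Fin n → Bool) (i : Fin n) (b : Bool) :
    vW n p (Function.update x i b) i = vW n p x i := by
  unfold vW
  apply Finset.prod_congr rfl
  intro j hj
  rw [Function.update_of_ne (Finset.ne_of_mem_erase hj)]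

lemma hasDerivAt_muW (n : ℕ) (p : ℝ) (x : Fin n → Bool) :
    HasDerivAt (fun q => muW n q x)
      (∑ i : Fin n, vW n p x i * (if x i then 1 else -1)) p := by
  unfold muW vW
  have := HasDerivAt.fun_finsetProd (u := (Finset.univ : Finset (Fin n))) (x := p)
    (f := fun i q => if x i then q else 1 - q) (f' := fun i => if x i then 1 else -1) (by
      intro i _
      cases x i
      · simpa using (hasDerivAt_id p).const_sub 1
      · simpa using hasDerivAt_id' p)
  simpa [smul_eq_mul] using this

lemma hasDerivAt_muP (n : ℕ) (p : ℝ) (A : Finset (Fin n → Bool)) :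
    HasDerivAt (fun q => muP n q A)
      (∑ x ∈ A, ∑ i : Fin n, vW n p x i * (if x i then 1 else -1)) p := by
  unfold muP
  exact HasDerivAt.fun_sum (fun x _ => hasDerivAt_muW n p x)

lemma deriv_bound (n k : ℕ) (p : ℝ) (h0 : 0 < p) (h1 : p < 1) (A : Finset (Fin n → Bool))
    (hA : ∀ x ∈ A, ∃ W : Finset (Fin n), W.card ≤ k ∧ (∀ i ∈ W, x i = true) ∧
      ∀ y : Fin n → Bool, (∀ i ∈ W, y i = true) → y ∈ A) :
    p * deriv (fun q => muP n q A) p ≤ k * muP n p A := by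
  classical
  rw [(hasDerivAt_muP n p A).deriv]
  choose! W hWc hW1 hWA using hA
  have key : ∀ i : Fin n, ∑ x ∈ A with (x i = true ∧ i ∉ W x), vW n p x i ≤
      ∑ x ∈ A with (x i = false), vW n p x i := by
    intro i
    have hinj : Set.InjOn (fun x : Fin n → Bool => Function.update x i false)
        ((A.filter (fun x => x i = true ∧ i ∉ W x) : Finset _) : Set (Fin n → Bool)) := by
      intro x hx y hy hxy
      simp only [Finset.coe_filter, Set.mem_ofPred_eq] at hx hy
      funext j
      by_cases hj : j = i
      · subst hj; rw [hx.2.1, hy.2.1]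
      · have := congrFun hxy j
        simpa [hj] using this
    calc ∑ x ∈ A with (x i = true ∧ i ∉ W x), vW n p x i
        = ∑ x ∈ A with (x i = true ∧ i ∉ W x), vW n p (Function.update x i false) i := by
          simp [vW_update]
      _ = ∑ y ∈ (A.filter (fun x => x i = true ∧ i ∉ W x)).image
            (fun x : Fin n → Bool => Function.update x i false), vW n p y i := by
          rw [Finset.sum_image hinj]
      _ ≤ _ := by
          apply Finset.sum_le_sum_of_subset_of_nonneg
          · intro y hy
            simp only [Finset.mem_image, Finset.mem_filter] at hy ⊢
            obtain ⟨x, ⟨hxA, hxi, hiW⟩, rfl⟩ := hy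
            refine ⟨hWA x hxA _ ?_, by simp⟩
            intro j hj
            have : j ≠ i := by rintro rfl; exact hiW hj
            rw [Function.update_of_ne this]
            exact hW1 x hxA j hj
          · intro y _ _
            exact vW_nonneg n p h0.le h1.le y i
  have h2 : ∑ x ∈ A, ∑ i : Fin n, vW n p x i * (if x i then 1 else -1) ≤
      ∑ x ∈ A, ∑ i ∈ W x, vW n p x i := by
    have e : ∀ x ∈ A, ∑ i : Fin n, vW n p x i * (if x i then 1 else -1) =
        ∑ i ∈ W x, vW n p x i + (∑ i : Fin n, (if x i = true ∧ i ∉ W x then vW n p x i else 0)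
          - ∑ i : Fin n, (if x i = false then vW n p x i else 0)) := by
      intro x hx
      rw [← Finset.sum_sub_distrib, ← Finset.sum_filter_add_sum_filter_not Finset.univ (· ∈ W x) (fun i => vW n p x i * _)]
      rw [show ∑ i ∈ W x, vW n p x i = ∑ i : Fin n, if i ∈ W x then vW n p x i else 0 by simp,
        Finset.sum_filter, Finset.sum_filter, ← Finset.sum_add_distrib, ← Finset.sum_add_distrib]
      apply Finset.sum_congr rfl
      intro i _
      by_cases hi : i ∈ W x
      · simp [hi, hW1 x hx i hi]
      · cases h : x i <;> simp [hi]
    rw [Finset.sum_congr rfl e, Finset.sum_add_distrib, Finset.sum_sub_distrib]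
    have : ∑ x ∈ A, ∑ i : Fin n, (if x i = true ∧ i ∉ W x then vW n p x i else 0) ≤
        ∑ x ∈ A, ∑ i : Fin n, (if x i = false then vW n p x i else 0) := by
      rw [Finset.sum_comm, Finset.sum_comm (s := A)]
      apply Finset.sum_le_sum
      intro i _
      rw [← Finset.sum_filter, ← Finset.sum_filter]
      exact key i
    linarith
  calc _ ≤ p * ∑ x ∈ A, ∑ i ∈ W x, vW n p x i := mul_le_mul_of_nonneg_left h2 h0.le
    _ = ∑ x ∈ A, (W x).card * muW n p x := by
      rw [Finset.mul_sum]
      apply Finset.sum_congr rfl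
      intro x hx
      rw [Finset.mul_sum, Finset.sum_congr rfl (fun i hi => p_mul_vW n p x i (hW1 x hx i hi))]
      simp
    _ ≤ _ := by
      unfold muP
      rw [Finset.mul_sum]
      apply Finset.sum_le_sum
      intro x hx
      apply mul_le_mul_of_nonneg_right _ (muW_pos n p h0 h1 x).le
      exact_mod_cast hWc x hx

lemma muP_window (n : ℕ) (p : ℝ) (W : Finset (Fin n)) :
    muP n p (Finset.univ.filter fun x => ∀ i ∈ W, x i = true) = p ^ W.card := by
  classical
  have : (Finset.univ.filter fun x : Fin n → Bool => ∀ i ∈ W, x i = true) =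
      Fintype.piFinset (fun i => if i ∈ W then ({true} : Finset Bool) else Finset.univ) := by
    ext x
    simp only [Finset.mem_filter, Finset.mem_univ, true_and, Fintype.mem_piFinset]
    refine forall_congr' fun i => ?_
    by_cases h : i ∈ W <;> simp [h]
  rw [this]
  unfold muP muW
  rw [← Finset.prod_univ_sum (fun i => if i ∈ W then ({true} : Finset Bool) else Finset.univ)
    (fun _ b => if b = true then p else 1 - p)]
  rw [← Finset.prod_const, ← Finset.prod_subset (Finset.subset_univ W)]
  · apply Finset.prod_congr rfl
    intro i hi
    simp [hi]
  · intro i _ hi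
    simp [hi]

def win (m k : ℕ) (i : Fin (m + 1)) : Finset (Fin (m + 1)) :=
  (Finset.range k).image (fun j => i + Fin.ofNat (m + 1) j)

def runSet (m k : ℕ) : Finset (Fin (m + 1) → Bool) :=
  Finset.univ.filter fun x => ∃ i, ∀ j ∈ win m k i, x j = true

lemma win_card_le (m k : ℕ) (i) : (win m k i).card ≤ k := by
  unfold win
  exact Finset.card_image_le.trans (by simp)

lemma win_card (m k : ℕ) (hk : k ≤ m + 1) (i) : (win m k i).card = k := by
  unfold win
  rw [Finset.card_image_of_injOn, Finset.card_range]
  intro a ha b hb hab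
  simp only [Finset.coe_range, Set.mem_Iio] at ha hb
  have h := congrArg Fin.val (add_left_cancel hab)
  simp only [Fin.ofNat] at h
  rwa [Nat.mod_eq_of_lt (by omega), Nat.mod_eq_of_lt (by omega)] at h

lemma runSet_monotone (m k : ℕ) : MonotoneSet (m + 1) (runSet m k) := by
  intro x hx y hxy
  simp only [runSet, Finset.mem_filter, Finset.mem_univ, true_and] at hx ⊢
  obtain ⟨i, hi⟩ := hx
  refine ⟨i, fun j hj => ?_⟩
  have := hxy j
  rw [hi j hj] at this
  exact top_le_iff.mp this

def transG (m : ℕ) : Subgroup (Equiv.Perm (Fin (m + 1))) where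
  carrier := {g | ∀ i j, g (i + j) = g i + j}
  mul_mem' := by
    intro a b ha hb i j
    simp only [Set.mem_ofPred_eq] at ha hb
    simp [hb, ha]
  one_mem' := by intro i j; simp
  inv_mem' := by
    intro a ha i j
    simp only [Set.mem_ofPred_eq] at ha
    rw [Equiv.Perm.inv_eq_iff_eq, ha]
    simp

lemma runSet_symm (m k : ℕ) : SymmetricSet (m + 1) (runSet m k) := by
  refine ⟨transG m, ?_, ?_⟩
  · intro i j
    refine ⟨Equiv.addLeft (j - i), ?_, by simp⟩
    intro a b
    simp [add_assoc]
  · intro g hg x hx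
    simp only [runSet, Finset.mem_filter, Finset.mem_univ, true_and] at hx ⊢
    obtain ⟨i, hi⟩ := hx
    refine ⟨g i, fun j hj => ?_⟩
    simp only [win, Finset.mem_image] at hj hi
    obtain ⟨t, ht, rfl⟩ := hj
    have hg' : g (i + Fin.ofNat (m + 1) t) = g i + Fin.ofNat (m + 1) t := hg _ _
    rw [← hg']
    simpa using hi _ ⟨t, ht, rfl⟩

lemma runSet_nonempty (m k : ℕ) : (runSet m k).Nonempty :=
  ⟨fun _ => true, by simp [runSet]⟩

lemma runSet_ne_univ (m k : ℕ) (hk : 1 ≤ k) : runSet m k ≠ Finset.univ := by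
  intro h
  have : (fun _ => false) ∈ runSet m k := h ▸ Finset.mem_univ _
  simp only [runSet, Finset.mem_filter, Finset.mem_univ, true_and] at this
  obtain ⟨i, hi⟩ := this
  have := hi (i + Fin.ofNat (m + 1) 0)
    (Finset.mem_image.mpr ⟨0, Finset.mem_range.mpr hk, rfl⟩)
  simp at this

lemma runSet_deriv (m k : ℕ) (p : ℝ) (h0 : 0 < p) (h1 : p < 1) :
    p * deriv (fun q => muP (m + 1) q (runSet m k)) p ≤ k * muP (m + 1) p (runSet m k) := by
  apply deriv_bound (m + 1) k p h0 h1
  intro x hx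
  simp only [runSet, Finset.mem_filter, Finset.mem_univ, true_and] at hx
  obtain ⟨i, hi⟩ := hx
  refine ⟨win m k i, win_card_le m k i, hi, fun y hy => ?_⟩
  simp only [runSet, Finset.mem_filter, Finset.mem_univ, true_and]
  exact ⟨i, hy⟩

lemma muP_pos (n : ℕ) (p : ℝ) (h0 : 0 < p) (h1 : p < 1) (A : Finset (Fin n → Bool))
    (hA : A.Nonempty) : 0 < muP n p A :=
  Finset.sum_pos (fun x _ => muW_pos n p h0 h1 x) hA

lemma runSet_le (m k : ℕ) (hk : k ≤ m + 1) (p : ℝ) (h0 : 0 < p) (h1 : p < 1) :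
    muP (m + 1) p (runSet m k) ≤ ((m + 1 : ℕ) : ℝ) * p ^ k := by
  classical
  have h : ∀ i, muP (m + 1) p (Finset.univ.filter fun x => ∀ j ∈ win m k i, x j = true) = p ^ k := by
    intro i
    rw [muP_window, win_card m k hk]
  have h2 : ((m + 1 : ℕ) : ℝ) * p ^ k = ∑ i : Fin (m + 1),
      muP (m + 1) p (Finset.univ.filter fun x => ∀ j ∈ win m k i, x j = true) := by
    rw [Finset.sum_congr rfl (fun i _ => h i)]
    simp
  rw [h2]
  unfold muP
  simp only [Finset.sum_filter, runSet]
  rw [Finset.sum_comm]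
  apply Finset.sum_le_sum
  intro x _
  have hx := (muW_pos (m + 1) p h0 h1 x).le
  have hnn : ∀ i ∈ (Finset.univ : Finset (Fin (m + 1))),
      0 ≤ (if ∀ j ∈ win m k i, x j = true then muW (m + 1) p x else 0) := by
    intro i _
    split_ifs <;> first | exact hx | exact le_rfl
  split_ifs with hc
  · obtain ⟨i, hi⟩ := hc
    have := Finset.single_le_sum hnn (Finset.mem_univ i)
    rwa [if_pos hi] at this
  · exact Finset.sum_nonneg hnn

/-- Lemma 5.1: if positive `f`, `g` and a positive sequence `a(n)` satisfy
`dμ_p(A)/dp ≥ (a(n)/g(p)) f(μ_p(A))` for all nontrivial monotone symmetric `A` and all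
`p ∈ (0,1)`, with `f(x)/x → 1` as `x → 0⁺` and `g(p)/(p log(1/p)) → 1` as `p → 0⁺`,
then `limsup_n a(n)/log n ≤ 1`. -/
theorem stmt19 (f g : ℝ → ℝ) (a : ℕ → ℝ)
    (hfpos : ∀ x ∈ Set.Ioo (0 : ℝ) 1, 0 < f x)
    (hgpos : ∀ p ∈ Set.Ioo (0 : ℝ) 1, 0 < g p)
    (hapos : ∀ n : ℕ, 0 < a n)
    (hflim : Filter.Tendsto (fun x => f x / x) (nhdsWithin 0 (Set.Ioi 0)) (nhds 1))
    (hglim : Filter.Tendsto (fun p => g p / (p * Real.log (1 / p)))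
      (nhdsWithin 0 (Set.Ioi 0)) (nhds 1))
    (hmain : ∀ n : ℕ, 0 < n → ∀ A : Finset (Fin n → Bool),
      MonotoneSet n A → SymmetricSet n A → A.Nonempty → A ≠ Finset.univ →
      ∀ p ∈ Set.Ioo (0 : ℝ) 1,
        deriv (fun q => muP n q A) p ≥ a n / g p * f (muP n p A)) :
    Filter.limsup (fun n : ℕ => a n / Real.log n) Filter.atTop ≤ 1 := by
  have hmain2 : ∀ η : ℝ, 0 < η → η < 1 → ∀ᶠ n : ℕ in Filter.atTop,
      a n * (1 - η) ≤ (1 + η) * ((1 + η) * Real.log n) := by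
    intro η hη hη1
    have hf := hflim.eventually (lt_mem_nhds (show 1 - η < 1 by linarith))
    have hg := hglim.eventually (gt_mem_nhds (show 1 < 1 + η by linarith))
    rw [eventually_nhdsWithin_iff, Metric.eventually_nhds_iff] at hf
    obtain ⟨δ0, hδ0, hf⟩ := hf
    obtain ⟨p, hgp, hp0, hp1⟩ := (hg.and (Ioo_mem_nhdsGT (show (0 : ℝ) < 1 by norm_num))).exists
    obtain ⟨δ, hδ, hδδ, hδ1⟩ : ∃ δ : ℝ, 0 < δ ∧ δ < δ0 ∧ δ < 1 :=
      ⟨min δ0 1 / 2, by positivity, by linarith [min_le_left δ0 1, lt_min hδ0 one_pos],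
        by linarith [min_le_right δ0 1]⟩
    set L := Real.log (1 / p) with hL
    have hLpos : 0 < L := Real.log_pos (by rw [lt_div_iff₀ hp0]; linarith)
    set D := Real.log (1 / δ) with hD
    have hDpos : 0 < D := Real.log_pos (by rw [lt_div_iff₀ hδ]; linarith)
    have hgle : g p ≤ (1 + η) * (p * L) := by
      rw [div_lt_iff₀ (by positivity)] at hgp
      exact hgp.le
    have hlogT : Filter.Tendsto (fun n : ℕ => Real.log n) Filter.atTop Filter.atTop :=
      Real.tendsto_log_atTop.comp tendsto_natCast_atTop_atTop
    have ev1 : ∀ᶠ n : ℕ in Filter.atTop, (D + L) / η ≤ Real.log n :=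
      hlogT.eventually_ge_atTop _
    have ev2 : ∀ᶠ n : ℕ in Filter.atTop, Real.log n ≤ L / (1 + η) * n := by
      have := (Real.isLittleO_log_id_atTop.comp_tendsto tendsto_natCast_atTop_atTop
        (k := fun n : ℕ => (n : ℝ))).bound (show 0 < L / (1 + η) by positivity)
      filter_upwards [this] with n hn
      simp only [Function.comp, id, Real.norm_eq_abs, Nat.abs_cast] at hn
      exact (le_abs_self _).trans hn
    filter_upwards [ev1, ev2, Filter.eventually_ge_atTop 1] with n h1 h2 hn
    obtain ⟨m, rfl⟩ : ∃ m, n = m + 1 := ⟨n - 1, by omega⟩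
    set N : ℝ := ((m + 1 : ℕ) : ℝ) with hN
    have hNpos : 0 < N := by positivity
    have hlogn : 0 ≤ Real.log N := Real.log_natCast_nonneg _
    set k := ⌈(Real.log N + D) / L⌉₊ with hk
    have hk1 : 1 ≤ k := Nat.one_le_ceil_iff.mpr (by positivity)
    have hkl : Real.log N + D ≤ k * L := by
      have := Nat.le_ceil ((Real.log N + D) / L)
      rwa [div_le_iff₀ hLpos] at this
    have hku : k * L ≤ (1 + η) * Real.log N := by
      have := (Nat.ceil_lt_add_one (show 0 ≤ (Real.log N + D) / L by positivity)).le
      have h3 : (k : ℝ) * L ≤ ((Real.log N + D) / L + 1) * L :=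
        mul_le_mul_of_nonneg_right this hLpos.le
      have h4 : ((Real.log N + D) / L + 1) * L = Real.log N + D + L := by field_simp
      rw [div_le_iff₀ hη] at h1
      linarith
    have hkn : k ≤ m + 1 := by
      have h3 : (k : ℝ) * L ≤ N * L := by
        refine hku.trans ?_
        calc (1 + η) * Real.log N ≤ (1 + η) * (L / (1 + η) * N) := by gcongr
          _ = N * L := by field_simp
      have h4 : (k : ℝ) ≤ ((m + 1 : ℕ) : ℝ) := le_of_mul_le_mul_right h3 hLpos
      exact Nat.cast_le.mp h4
    set μ := muP (m + 1) p (runSet m k) with hμ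
    have hμpos : 0 < μ := muP_pos _ p hp0 hp1 _ (runSet_nonempty m k)
    have hμle : μ ≤ δ := by
      refine (runSet_le m k hkn p hp0 hp1).trans ?_
      rw [← Real.log_le_log_iff (by positivity) hδ, Real.log_mul hNpos.ne' (by positivity),
        Real.log_pow]
      rw [hL, hD, one_div, one_div, Real.log_inv, Real.log_inv] at hkl
      linarith
    have hfμ := hf (y := μ) (by rw [Real.dist_eq, sub_zero, abs_of_pos hμpos]; linarith) hμpos
    rw [lt_div_iff₀ hμpos] at hfμ
    have hder := runSet_deriv m k p hp0 hp1
    have hm := hmain (m + 1) (by omega) (runSet m k) (runSet_monotone m k) (runSet_symm m k)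
      (runSet_nonempty m k) (runSet_ne_univ m k hk1) p ⟨hp0, hp1⟩
    rw [← hμ] at hm hder
    set d := deriv (fun q => muP (m + 1) q (runSet m k)) p
    have hgp0 := hgpos p ⟨hp0, hp1⟩
    have ha := hapos (m + 1)
    have hm' : a (m + 1) * f μ ≤ g p * d := by
      have := mul_le_mul_of_nonneg_left hm hgp0.le
      calc a (m + 1) * f μ = g p * (a (m + 1) / g p * f μ) := by field_simp
        _ ≤ _ := this
    have hf0 : 0 < f μ := hfpos μ ⟨hμpos, by linarith⟩
    have hd : 0 < d := by
      by_contra hcon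
      have : g p * d ≤ 0 := mul_nonpos_of_nonneg_of_nonpos hgp0.le (not_lt.mp hcon)
      have : 0 < a (m + 1) * f μ := by positivity
      linarith
    have hfin : (a (m + 1) * (1 - η)) * μ ≤ ((1 + η) * ((1 + η) * Real.log N)) * μ := by
      calc (a (m + 1) * (1 - η)) * μ = a (m + 1) * ((1 - η) * μ) := by ring
        _ ≤ a (m + 1) * f μ := by gcongr
        _ ≤ g p * d := hm'
        _ ≤ (1 + η) * (p * L) * d := by gcongr
        _ = (1 + η) * L * (p * d) := by ring
        _ ≤ (1 + η) * L * (k * μ) := by gcongr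
        _ = (1 + η) * (k * L) * μ := by ring
        _ ≤ _ := by gcongr
    exact le_of_mul_le_mul_right hfin hμpos
  apply le_of_forall_pos_le_add
  intro ε hε
  have hbdd : Filter.IsBoundedUnder (· ≥ ·) Filter.atTop (fun n : ℕ => a n / Real.log n) :=
    ⟨0, Filter.eventually_map.mpr (Filter.Eventually.of_forall fun n =>
      div_nonneg (hapos n).le (Real.log_natCast_nonneg n))⟩
  refine Filter.limsup_le_of_le hbdd.isCoboundedUnder_le ?_
  obtain ⟨η, hη, hη1, hηε⟩ : ∃ η : ℝ, 0 < η ∧ η ≤ 1 / 5 ∧ 5 * η ≤ ε :=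
    ⟨min ε 1 / 5, by positivity, by linarith [min_le_right ε 1], by linarith [min_le_left ε 1]⟩
  filter_upwards [hmain2 η hη (by linarith), Filter.eventually_ge_atTop 2] with n hn hn2
  have hlog : 0 < Real.log n := Real.log_pos (by exact_mod_cast hn2)
  rw [div_le_iff₀ hlog]
  have h1 : (1 + η) * (1 + η) ≤ (1 + ε) * (1 - η) := by nlinarith
  have h2 : a n * (1 - η) ≤ ((1 + ε) * Real.log n) * (1 - η) := by
    calc _ ≤ _ := hn
      _ = ((1 + η) * (1 + η)) * Real.log n := by ring
      _ ≤ ((1 + ε) * (1 - η)) * Real.log n := by gcongr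
      _ = _ := by ring
  exact le_of_mul_le_mul_right h2 (by linarith)
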